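/- The triple (R(K_2, Σ_2), ≤, r) is a topological Ramsey space, and R(K_2, Σ_2) is dense in the partial ordering PC_∞(K_2, Σ_2) of all pure candidates (i.e., for every t̄ ∈ PC_∞(K_2, Σ_2) there is s̄ ∈ R(K_2, Σ_2) with s̄ ≤ t̄). -/

import Mathlib

open Filter

/- Example 2.11 of Roslanowski–Shelah.  H_2(n) = 2.  An element of K_2 is an FP
creature t = (nor[t], val[t], dis[t], m^t_dn, m^t_up) with ∅ ≠ dis[t] ⊆ [m^t_dn, m^t_up),
∅ ≠ val[t] ⊆ 2^{dis[t]} and nor[t] = log₂|val[t]|.  Partial finitary functions are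
modelled as f : ℕ → Option ℕ, with domain {j | (f j).isSome}. -/
structure Creature2 where
  mdn : ℕ
  mup : ℕ
  hm : mdn < mup
  dis : Finset ℕ
  hdisne : dis.Nonempty
  hdis : dis ⊆ Finset.Ico mdn mup
  val : Finset (ℕ → Option ℕ)
  hvalne : val.Nonempty
  hdom : ∀ f ∈ val, ∀ j, (f j).isSome ↔ j ∈ dis
  hran : ∀ f ∈ val, ∀ j a, f j = some a → a < 2
  nor : ℝ
  hnor : nor = Real.logb 2 (val.card)

/- Σ_2(s̄↾u) for a nonempty finite u ⊆ ω (with s̄↾u = (s_i : i ∈ u)): creatures t with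
m^t_dn = m^{s_{min u}}_dn, m^t_up = m^{s_{max u}}_up, and dis[t] = dis[s_{l*}],
val[t] ⊆ val[s_{l*}] for some l* ∈ u. -/
def Sigma2 (s : ℕ → Creature2) (u : Finset ℕ) : Set Creature2 :=
  {t | ∃ hu : u.Nonempty,
    t.mdn = (s (u.min' hu)).mdn ∧ t.mup = (s (u.max' hu)).mup ∧
    ∃ l ∈ u, t.dis = (s l).dis ∧ t.val ⊆ (s l).val}

/- Pure candidates: m^{t_n}_up ≤ m^{t_{n+1}}_dn and nor[t_n] → ∞. -/
def PC2 (t : ℕ → Creature2) : Prop :=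
  (∀ n, (t n).mup ≤ (t (n + 1)).mdn) ∧
  Tendsto (fun n => (t n).nor) atTop atTop

/- t̄ ≤ s̄ iff there are finite nonempty u_n ⊆ ω with max(u_n) < min(u_{n+1}) and
t_n ∈ Σ_2(s̄↾u_n) for all n. -/
def le2 (t s : ℕ → Creature2) : Prop :=
  ∃ u : ℕ → Finset ℕ, (∀ n, (u n).Nonempty) ∧
    (∀ n, ∀ a ∈ u n, ∀ b ∈ u (n + 1), a < b) ∧
    ∀ n, t n ∈ Sigma2 s (u n)

/- Membership in R(K_2, Σ_2): pure candidates with |val[t_l]| = l + 1 for all l. -/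
def R2cond (t : ℕ → Creature2) : Prop :=
  PC2 t ∧ ∀ l, (t l).val.card = l + 1

/- r_k(t̄) = (t_0, …, t_{k−1}). -/
def restr2 (t : ℕ → Creature2) (k : ℕ) : List Creature2 :=
  List.ofFn (fun i : Fin k => t i.1)

/- The space R(K_2, Σ_2). -/
def R2 := {t : ℕ → Creature2 // R2cond t}

/- The Ellentuck basic set [a, X] = {Y : Y ≤ X and r_{|a|}(Y) = a}. -/
def EBasic2 (a : List Creature2) (X : R2) : Set R2 :=
  {Y | le2 Y.1 X.1 ∧ restr2 Y.1 a.length = a}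

/- The Ellentuck topology, generated by the sets [a, X]. -/
def ellT2 : TopologicalSpace R2 :=
  TopologicalSpace.generateFrom {S | ∃ a X, S = EBasic2 a X}

/- 𝓧 is Ramsey: for every nonempty [a, X] there is Y ∈ [a, X] with [a, Y] ⊆ 𝓧 or
[a, Y] ∩ 𝓧 = ∅. -/
def Ramsey2 (𝓧 : Set R2) : Prop :=
  ∀ a X, (EBasic2 a X).Nonempty →
    ∃ Y ∈ EBasic2 a X, EBasic2 a Y ⊆ 𝓧 ∨ EBasic2 a Y ∩ 𝓧 = ∅

/- 𝓧 is Ramsey null: for every nonempty [a, X] there is Y ∈ [a, X] with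
[a, Y] ∩ 𝓧 = ∅. -/
def RamseyNull2 (𝓧 : Set R2) : Prop :=
  ∀ a X, (EBasic2 a X).Nonempty → ∃ Y ∈ EBasic2 a X, EBasic2 a Y ∩ 𝓧 = ∅

/- 𝓧 has the property of Baire in the Ellentuck topology. -/
def BaireProp2 (𝓧 : Set R2) : Prop :=
  ∃ O : Set R2, @IsOpen R2 ellT2 O ∧ @IsMeagre R2 ellT2 (symmDiff 𝓧 O)

/-! Finite Ramsey -/
def RHom {α : Type*} (c : Finset α → Prop) (k : ℕ) (d : Prop) (B : Finset α) : Prop :=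
  ∀ V ⊆ B, V.card = k → (c V ↔ d)

open Classical in
theorem ramsey_aux {α : Type*} (k : ℕ) : ∀ s t : ℕ, ∃ N : ℕ, ∀ A : Finset α, N ≤ A.card →
    ∀ c : Finset α → Prop, (∃ B ⊆ A, B.card = s ∧ RHom c k True B) ∨
      (∃ B ⊆ A, B.card = t ∧ RHom c k False B) := by
  induction k with
  | zero =>
    intro s t
    refine ⟨max s t, fun A hA c => ?_⟩
    by_cases h : c ∅
    · left
      obtain ⟨B, hB, hc⟩ := Finset.exists_subset_card_eq (le_trans (le_max_left s t) hA)
      refine ⟨B, hB, hc, fun V _ hV => ?_⟩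
      rw [Finset.card_eq_zero.1 hV]; simp [h]
    · right
      obtain ⟨B, hB, hc⟩ := Finset.exists_subset_card_eq (le_trans (le_max_right s t) hA)
      refine ⟨B, hB, hc, fun V _ hV => ?_⟩
      rw [Finset.card_eq_zero.1 hV]; simp [h]
  | succ k ih =>
    have emp : ∀ (c : Finset α → Prop) d, RHom c (k+1) d ∅ := by
      intro c d V hV hc
      rw [Finset.subset_empty.1 hV] at hc; simp at hc
    have ext : ∀ (c : Finset α → Prop) (d : Prop) (x : α) (B : Finset α), 
        RHom (fun V => c (insert x V)) k d B → RHom c (k+1) d B → RHom c (k+1) d (insert x B) := by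
      intro c d x B h1 h2 V hV hc
      by_cases hx : x ∈ V
      · have := h1 (V.erase x) (by
          intro y hy
          have := hV (Finset.mem_of_mem_erase hy)
          rcases Finset.mem_insert.1 this with h | h
          · exact absurd h (Finset.ne_of_mem_erase hy)
          · exact h) (by rw [Finset.card_erase_of_mem hx, hc]; rfl)
        simpa [Finset.insert_erase hx] using this
      · exact h2 V ((Finset.subset_insert_iff_of_notMem hx).1 hV) hc
    intro s
    induction s with
    | zero => intro t; exact ⟨0, fun A _ c => Or.inl ⟨∅, by simp, by simp, emp _ _⟩⟩
    | succ s ihs =>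
      intro t
      induction t with
      | zero => exact ⟨0, fun A _ c => Or.inr ⟨∅, by simp, by simp, emp _ _⟩⟩
      | succ t iht =>
        obtain ⟨N1, h1⟩ := ihs (t+1)
        obtain ⟨N2, h2⟩ := iht
        obtain ⟨N, h⟩ := ih N1 N2
        refine ⟨N+1, fun A hA c => ?_⟩
        obtain ⟨x, hx⟩ : A.Nonempty := by
          rw [← Finset.card_pos]; omega
        have hsub : ∀ B B' : Finset α, B ⊆ A.erase x → B' ⊆ B → insert x B' ⊆ A := by
          intro B B' h1 h2 y hy
          rcases Finset.mem_insert.1 hy with h | h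
          · exact h ▸ hx
          · exact Finset.mem_of_mem_erase (h1 (h2 h))
        have hnx : ∀ B B' : Finset α, B ⊆ A.erase x → B' ⊆ B → x ∉ B' := by
          intro B B' h1 h2 h3
          exact absurd (h1 (h2 h3)) (by simp)
        have hbs : ∀ B B' : Finset α, B ⊆ A.erase x → B' ⊆ B → B' ⊆ A := by
          intro B B' h1 h2 
          exact h2.trans (h1.trans (Finset.erase_subset _ _))
        have hm : ∀ (d : Prop) (B B' : Finset α), B' ⊆ B → RHom (fun V => c (insert x V)) k d B →
            RHom (fun V => c (insert x V)) k d B' := fun d B B' hs hB V hV => hB V (hV.trans hs)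
        rcases h (A.erase x) (by rw [Finset.card_erase_of_mem hx]; omega)
          (fun V => c (insert x V)) with ⟨B, hB, hBc, hBr⟩ | ⟨B, hB, hBc, hBr⟩
        · rcases h1 B hBc.ge c with ⟨B', hB', hc', hr'⟩ | ⟨B', hB', hc', hr'⟩
          · exact Or.inl ⟨insert x B', hsub _ _ hB hB', by
              rw [Finset.card_insert_of_notMem (hnx _ _ hB hB'), hc'],
              ext _ _ _ _ (hm _ _ _ hB' hBr) hr'⟩
          · exact Or.inr ⟨B', hbs _ _ hB hB', hc', hr'⟩
        · rcases h2 B hBc.ge c with ⟨B', hB', hc', hr'⟩ | ⟨B', hB', hc', hr'⟩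
          · exact Or.inl ⟨B', hbs _ _ hB hB', hc', hr'⟩
          · exact Or.inr ⟨insert x B', hsub _ _ hB hB', by
              rw [Finset.card_insert_of_notMem (hnx _ _ hB hB'), hc'],
              ext _ _ _ _ (hm _ _ _ hB' hBr) hr'⟩

theorem ramsey_multi {α : Type*} (k n : ℕ) : ∀ F : ℕ, ∃ N : ℕ, ∀ A : Finset α, N ≤ A.card →
    ∀ c : ℕ → Finset α → Prop, ∃ B ⊆ A, n ≤ B.card ∧ 
      ∀ i < F, RHom (c i) k True B ∨ RHom (c i) k False B := by
  intro F
  induction F with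
  | zero => exact ⟨n, fun A hA c => ⟨A, by simp, hA, by simp⟩⟩
  | succ F ih =>
    obtain ⟨N, hN⟩ := ih
    obtain ⟨M, hM⟩ := ramsey_aux (α := α) k N N
    refine ⟨M, fun A hA c => ?_⟩
    have : ∃ B ⊆ A, B.card = N ∧ (RHom (c F) k True B ∨ RHom (c F) k False B) := by
      rcases hM A hA (c F) with ⟨B, h1, h2, h3⟩ | ⟨B, h1, h2, h3⟩
      · exact ⟨B, h1, h2, Or.inl h3⟩
      · exact ⟨B, h1, h2, Or.inr h3⟩
    obtain ⟨B, h1, h2, h3⟩ := this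
    obtain ⟨B', h1', h2', h3'⟩ := hN B h2.ge c
    refine ⟨B', h1'.trans h1, h2', fun i hi => ?_⟩
    rcases Nat.lt_succ_iff_lt_or_eq.1 hi with h | h
    · exact h3' i h
    · subst h
      exact h3.imp (fun h V hV => h V (hV.trans h1')) (fun h V hV => h V (hV.trans h1'))

theorem ult_iff (U : Ultrafilter ℕ) (p : ℕ → Prop) : 
    ∀ᶠ x in (U : Filter ℕ), (p x ↔ ∀ᶠ y in (U : Filter ℕ), p y) := by
  by_cases h : ∀ᶠ y in (U : Filter ℕ), p y
  · filter_upwards [h] with x hx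
    exact ⟨fun _ => h, fun _ => hx⟩
  · have h' := (Ultrafilter.eventually_not (f := U)).2 h
    filter_upwards [h'] with x hx
    exact ⟨fun h => absurd h hx, fun h' => absurd h' h⟩

/-- the combinatorial core -/
theorem comb {α : Type*} (A : ℕ → Finset α) (hA : ∀ l, (A l).card = l + 1) (k K : ℕ)
    (c : ℕ → ℕ → ℕ → Finset α → Prop) :
    ∃ (p l q : ℕ → ℕ) (B : ℕ → Finset α) (d : Prop), 
      (∀ n, k ≤ p n ∧ p n ≤ l n ∧ l n ≤ q n ∧ q n < p (n+1) ∧ B n ⊆ A (l n) ∧ (B n).card = k + n + 1) ∧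
      ∀ i j r, i ≤ j → j ≤ r → ∀ V ⊆ B j, V.card = K → (c (p i) (l j) (q r) V ↔ d) := by
  classical
  let U : Ultrafilter ℕ := Filter.hyperfilter ℕ
  have hU : ∀ n : ℕ, ∀ᶠ x in (U : Filter ℕ), n < x := by
    intro n
    have : (U : Filter ℕ) ≤ atTop := by
      rw [← Nat.cofinite_eq_atTop]; exact Filter.hyperfilter_le_cofinite
    exact this (eventually_gt_atTop n)
  let c1 : ℕ → ℕ → Finset α → Prop := fun m l V => ∀ᶠ M in (U : Filter ℕ), c m l M V
  have h1 : ∀ N, ∃ l B, N ≤ l ∧ B ⊆ A l ∧ N ≤ B.card ∧ 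
      ∀ m < N, RHom (c1 m l) K True B ∨ RHom (c1 m l) K False B := by
    intro N
    obtain ⟨M, hM⟩ := ramsey_multi (α := α) K N N
    obtain ⟨B, h1, h2, h3⟩ := hM (A (max M N)) (by rw [hA]; omega) (fun m => c1 m (max M N))
    exact ⟨max M N, B, le_max_right _ _, h1, h2, h3⟩
  choose l B hlN hBA hBc hhom using h1
  let c2 : ℕ → Prop := fun m => ∀ᶠ N in (U : Filter ℕ), RHom (c1 m (l N)) K True (B N)
  let d : Prop := ∀ᶠ m in (U : Filter ℕ), c2 m
  have hD : ∀ᶠ m in (U : Filter ℕ), ∀ᶠ N in (U : Filter ℕ), RHom (c1 m (l N)) K d (B N) := by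
    filter_upwards [ult_iff U c2] with m hm
    by_cases hd : d
    · filter_upwards [hm.2 hd] with N hN V hV hc
      rw [hN V hV hc]; simp [hd]
    · have : ¬ c2 m := fun h => hd (hm.1 h)
      filter_upwards [(Ultrafilter.eventually_not (f := U)).2 this, hU m] with N hN hmN V hV hc
      have := (hhom N m hmN).resolve_left hN
      rw [this V hV hc]; simp [hd]
  -- the function g
  have hg : ∀ N, ∃ q, l N < q ∧ ∀ N' ≤ N, ∀ m ≤ N', ∀ V ⊆ B N', 
      (c m (l N') q V ↔ c1 m (l N') V) := by
    intro N
    have e : ∀ᶠ q in (U : Filter ℕ), ∀ N' ∈ Set.Iic N, ∀ m ∈ Set.Iic N', ∀ V ∈ ((B N').powerset : Set (Finset α)),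
      (c m (l N') q V ↔ c1 m (l N') V) := by
      refine (Filter.eventually_all_finite (Set.finite_Iic N)).2 fun N' _ => ?_
      refine (Filter.eventually_all_finite (Set.finite_Iic N')).2 fun m _ => ?_
      refine (Filter.eventually_all_finite (Finset.finite_toSet _)).2 fun V _ => ?_
      exact ult_iff U _
    obtain ⟨q, h1, h2⟩ := ((hU (l N)).and e).exists
    exact ⟨q, h1, fun N' hN' m hm V hV => h2 N' hN' m hm V (by simpa using hV)⟩
  choose g hgl hg using hg
  obtain ⟨f, hf1, hf2⟩ := exists_seq_of_forall_finset_exists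
    (α := ℕ × ℕ) (fun x => (∀ᶠ N in (U : Filter ℕ), RHom (c1 x.1 (l N)) K d (B N)) ∧ k ≤ x.1 ∧ x.1 < x.2 ∧
      RHom (c1 x.1 (l x.2)) K d (B x.2))
    (fun x y => g x.2 < y.1 ∧ RHom (c1 x.1 (l y.2)) K d (B y.2)) (by
      intro s hs
      have e1 : ∀ᶠ p in (U : Filter ℕ), ∀ x ∈ (s : Set (ℕ × ℕ)), g x.2 < p :=
        (Filter.eventually_all_finite (Finset.finite_toSet _)).2 fun x _ => hU _
      obtain ⟨p, hp1, hp2, hp3⟩ := (e1.and (hD.and (hU k))).exists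
      have e2 : ∀ᶠ N in (U : Filter ℕ), ∀ x ∈ (s : Set (ℕ × ℕ)), RHom (c1 x.1 (l N)) K d (B N) :=
        (Filter.eventually_all_finite (Finset.finite_toSet _)).2 fun x hx => (hs x hx).1
      obtain ⟨N, hN1, hN2, hN3⟩ := (e2.and (hp2.and (hU p))).exists
      exact ⟨(p, N), ⟨hp2, hp3.le, hN3, hN2⟩, fun x hx => ⟨hp1 x hx, hN1 x hx⟩⟩)
  have hlg : ∀ n, (f n).2 < g (f n).2 := fun n => lt_of_le_of_lt (hlN _) (hgl _)
  have hNs : ∀ n, (f n).2 < (f (n+1)).2 := fun n => 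
    (hlg n).trans ((hf2 n (n+1) (by omega)).1.trans (hf1 (n+1)).2.2.1)
  have hNm : StrictMono (fun n => (f n).2) := strictMono_nat_of_lt_succ hNs
  have hNk : ∀ n, k + n + 1 ≤ (f n).2 := by
    intro n
    induction n with
    | zero => have := (hf1 0).2; omega
    | succ n ih => have := hNs n; omega
  have hB' : ∀ n, ∃ B' ⊆ B (f n).2, B'.card = k + n + 1 := fun n => 
    Finset.exists_subset_card_eq ((hNk n).trans (hBc _))
  choose B' hB'1 hB'2 using hB'
  refine ⟨fun n => (f n).1, fun n => l (f n).2, fun n => g (f n).2, B', d, fun n => ?_, ?_⟩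
  · exact ⟨(hf1 n).2.1, (hf1 n).2.2.1.le.trans (hlN _), (hgl _).le, (hf2 n (n+1) (by omega)).1,
      (hB'1 n).trans (hBA _), hB'2 n⟩
  · intro i j r hij hjr V hV hc
    have hV' := hV.trans (hB'1 j)
    have e1 : RHom (c1 (f i).1 (l (f j).2)) K d (B (f j).2) := by
      rcases hij.eq_or_lt with h | h
      · subst h; exact (hf1 i).2.2.2
      · exact (hf2 i j h).2
    rw [← e1 V hV' hc]
    exact hg _ _ (hNm.monotone hjr) _ ((hf1 i).2.2.1.le.trans (hNm.monotone hij)) V hV'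
/-! Structure of the space -/
theorem ceq {s t : Creature2} (h1 : s.mdn = t.mdn) (h2 : s.mup = t.mup) (h3 : s.dis = t.dis)
    (h4 : s.val = t.val) : s = t := by
  cases s; cases t
  simp only at h1 h2 h3 h4
  subst h1 h2 h3 h4
  simp_all

def Blk (X : ℕ → Creature2) (t : Creature2) : Prop :=
  ∃ i l j, i ≤ l ∧ l ≤ j ∧ t.mdn = (X i).mdn ∧ t.mup = (X j).mup ∧
    t.dis = (X l).dis ∧ t.val ⊆ (X l).val

def Chain (X : ℕ → Creature2) : Prop := ∀ n, (X n).mup ≤ (X (n + 1)).mdn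

theorem Chain.lt {X : ℕ → Creature2} (h : Chain X) {i j : ℕ} (hij : i < j) :
    (X i).mup ≤ (X j).mdn := by
  induction j with
  | zero => omega
  | succ j ih =>
    rcases Nat.lt_succ_iff_lt_or_eq.1 hij with h' | h'
    · exact (ih h').trans ((X j).hm.le.trans (h j))
    · subst h'; exact h i

theorem Chain.mdn_le {X : ℕ → Creature2} (h : Chain X) {i j : ℕ} (hij : i ≤ j) :
    (X i).mdn ≤ (X j).mdn := by
  rcases hij.eq_or_lt with e | e
  · rw [e]
  · exact (X i).hm.le.trans (h.lt e)

theorem Chain.mup_le {X : ℕ → Creature2} (h : Chain X) {i j : ℕ} (hij : i ≤ j) :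
    (X i).mup ≤ (X j).mup := by
  rcases hij.eq_or_lt with e | e
  · rw [e]
  · exact (h.lt e).trans (X j).hm.le

theorem Chain.idx_lt {X : ℕ → Creature2} (h : Chain X) {i j : ℕ} (hij : (X i).mup ≤ (X j).mdn) :
    i < j := by
  by_contra hc
  have := h.mdn_le (not_lt.1 hc)
  have := (X i).hm
  omega

theorem blk_self (X : ℕ → Creature2) (n : ℕ) : Blk X (X n) :=
  ⟨n, n, n, le_rfl, le_rfl, rfl, rfl, rfl, fun _ h => h⟩

theorem le2_iff {X Y : ℕ → Creature2} (hX : Chain X) (hY : Chain Y) :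
    le2 Y X ↔ ∀ n, Blk X (Y n) := by
  constructor
  · rintro ⟨u, _, _, h⟩ n
    obtain ⟨hu, h1, h2, l, hl, h3, h4⟩ := h n
    exact ⟨_, l, _, Finset.min'_le _ _ hl, Finset.le_max' _ _ hl, h1, h2, h3, h4⟩
  · intro h
    choose i l j hil hlj h1 h2 h3 h4 using h
    have hlo : ∀ n, ∀ a ∈ ({i n, l n, j n} : Finset ℕ), i n ≤ a ∧ a ≤ j n := by
      intro n a ha
      have := hil n
      have := hlj n
      simp only [Finset.mem_insert, Finset.mem_singleton] at ha
      omega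
    refine ⟨fun n => {i n, l n, j n}, fun n => by simp, ?_, ?_⟩
    · intro n a ha b hb
      have e1 := hlo n a ha
      have e2 := hlo (n+1) b hb
      have : j n < i (n+1) := hX.idx_lt (by rw [← h1, ← h2]; exact hY n)
      omega
    · intro n
      have hu : ({i n, l n, j n} : Finset ℕ).Nonempty := by simp
      have m1 : ({i n, l n, j n} : Finset ℕ).min' hu = i n :=
        le_antisymm (Finset.min'_le _ _ (by simp)) (hlo n _ (Finset.min'_mem _ _)).1
      have m2 : ({i n, l n, j n} : Finset ℕ).max' hu = j n :=
        le_antisymm (hlo n _ (Finset.max'_mem _ _)).2 (Finset.le_max' _ _ (by simp))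
      exact ⟨hu, by rw [m1]; exact h1 n, by rw [m2]; exact h2 n, l n, by simp, h3 n, h4 n⟩

theorem R2.chain (X : R2) : Chain X.1 := X.2.1.1
theorem R2.card (X : R2) (n : ℕ) : (X.1 n).val.card = n + 1 := X.2.2 n

theorem mkR {t : ℕ → Creature2} (h : Chain t) (hc : ∀ n, (t n).val.card = n + 1) : R2cond t := by
  refine ⟨⟨h, ?_⟩, hc⟩
  have : (fun n => (t n).nor) = fun n : ℕ => Real.logb 2 ((n : ℝ) + 1) := by
    funext n
    rw [(t n).hnor, hc n]; push_cast; rfl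
  rw [this]
  exact (Real.tendsto_logb_atTop (by norm_num)).comp
    (tendsto_atTop_add_const_right _ _ tendsto_natCast_atTop_atTop)

theorem Blk.trans {X Y : ℕ → Creature2} (hX : Chain X) (hYX : ∀ n, Blk X (Y n)) (hY : Chain Y)
    {t : Creature2} (ht : Blk Y t) : Blk X t := by
  obtain ⟨i, l, j, hil, hlj, h1, h2, h3, h4⟩ := ht
  obtain ⟨i1, l1, j1, a1, b1, c1, d1, e1, f1⟩ := hYX i
  obtain ⟨i2, l2, j2, a2, b2, c2, d2, e2, f2⟩ := hYX l
  obtain ⟨i3, l3, j3, a3, b3, c3, d3, e3, f3⟩ := hYX j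
  have g1 : i1 ≤ l2 := by
    rcases hil.eq_or_lt with h | h
    · subst h
      have : (X i1).mdn < (X (l2+1)).mdn := by
        rw [← c1, c2]
        exact lt_of_le_of_lt (hX.mdn_le a2) (lt_of_lt_of_le (X l2).hm (hX l2))
      by_contra hc
      have := hX.mdn_le (show l2 + 1 ≤ i1 by omega)
      omega
    · have : j1 < i2 := hX.idx_lt (by rw [← d1, ← c2]; exact hY.lt h)
      omega
  have g2 : l2 ≤ j3 := by
    rcases hlj.eq_or_lt with h | h
    · subst h
      by_contra hc
      have := hX.lt (not_le.1 hc)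
      have := (X l2).hm
      have := hX.mup_le b2
      omega
    · have : j2 < i3 := hX.idx_lt (by rw [← d2, ← c3]; exact hY.lt h)
      omega
  exact ⟨i1, l2, j3, g1, g2, h1.trans c1, h2.trans d3, h3.trans e2, h4.trans f2⟩

/-- pointwise order -/
def SubR (Y X : R2) : Prop := ∀ n, Blk X.1 (Y.1 n)

theorem SubR.rfl' (X : R2) : SubR X X := fun n => blk_self _ n
theorem SubR.tr {X Y Z : R2} (h1 : SubR Z Y) (h2 : SubR Y X) : SubR Z X :=
  fun n => Blk.trans X.chain h2 Y.chain (h1 n)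

theorem restr_eq {Y W : ℕ → Creature2} {j : ℕ} :
    restr2 Y j = restr2 W j ↔ ∀ i < j, Y i = W i := by
  unfold restr2
  rw [List.ofFn_inj]
  constructor
  · intro h i hi
    exact congrFun h ⟨i, hi⟩
  · intro h
    funext i
    exact h i.1 i.2

theorem restr_len (Y : ℕ → Creature2) (j : ℕ) : (restr2 Y j).length = j := by simp [restr2]

theorem memE {b : List Creature2} {X Y : R2} :
    Y ∈ EBasic2 b X ↔ SubR Y X ∧ restr2 Y.1 b.length = b := by
  unfold EBasic2 SubR
  rw [Set.mem_ofPred_eq, le2_iff X.chain Y.chain]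

theorem memE' {W : R2} {j : ℕ} {X Y : R2} :
    Y ∈ EBasic2 (restr2 W.1 j) X ↔ SubR Y X ∧ ∀ i < j, Y.1 i = W.1 i := by
  rw [memE, restr_len, restr_eq]

theorem E_mono {b : List Creature2} {X Y : R2} (h : SubR Y X) : EBasic2 b Y ⊆ EBasic2 b X := by
  intro V hV
  rw [memE] at *
  exact ⟨hV.1.tr h, hV.2⟩

def top (X : ℕ → Creature2) : ℕ → ℕ
  | 0 => 0
  | m+1 => (X m).mup

theorem top_congr {X Y : ℕ → Creature2} {m : ℕ} (h : ∀ i < m, X i = Y i) : top X m = top Y m := by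
  cases m with
  | zero => rfl
  | succ m => simp [top, h m (by omega)]

theorem top_le {X : ℕ → Creature2} (h : Chain X) {m i : ℕ} (hi : m ≤ i) : top X m ≤ (X i).mdn := by
  cases m with
  | zero => simp [top]
  | succ m => exact h.lt (by omega)

theorem idx_ge {X : ℕ → Creature2} (h : Chain X) {m i : ℕ} (hi : top X m ≤ (X i).mdn) : m ≤ i := by
  cases m with
  | zero => omega
  | succ m => exact h.idx_lt hi

theorem len_le_top (X : R2) (j : ℕ) : j ≤ top X.1 j := by
  induction j with
  | zero => omega
  | succ j ih =>
    have := top_le X.chain (le_refl j)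
    have := (X.1 j).hm
    simp only [top]
    omega

theorem mup_le_top {X : ℕ → Creature2} (h : Chain X) {i j : ℕ} (hi : i < j) : (X i).mup ≤ top X j := by
  cases j with
  | zero => omega
  | succ j => exact h.mup_le (by omega)

/-- every approximation of W ≤ Y has a depth in Y -/
theorem depth {W Y : R2} (h : SubR W Y) (j : ℕ) : ∃ m, top W.1 j = top Y.1 m := by
  cases j with
  | zero => exact ⟨0, rfl⟩
  | succ j =>
    obtain ⟨i, l, q, _, _, _, h2, _⟩ := h j
    exact ⟨q+1, h2⟩

theorem depth_ge {W Y : R2} (h : SubR W Y) {j m : ℕ} (hm : top W.1 j = top Y.1 m) : j ≤ m := by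
  cases j with
  | zero => omega
  | succ j =>
    obtain ⟨i, l, q, _, hlq, _, h2, _, h4⟩ := h j
    have hc := Finset.card_le_card h4
    rw [W.card, Y.card] at hc
    have : q < m := by
      by_contra hc
      have e1 := top_le Y.chain (not_lt.1 hc)
      have := (Y.1 q).hm
      change (W.1 j).mup = top Y.1 m at hm
      omega
    omega

theorem fin_creature (N : ℕ) : {t : Creature2 | t.mup ≤ N}.Finite := by
  classical
  let G : (Fin N → Option (Fin 2)) → (ℕ → Option ℕ) := fun g j =>
    if h : j < N then (g ⟨j, h⟩).map Fin.val else none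
  let F : Finset (ℕ → Option ℕ) := (Set.finite_range G).toFinset
  let T := (Finset.range (N+1)) ×ˢ (Finset.range (N+1)) ×ˢ (Finset.range N).powerset ×ˢ F.powerset
  refine Set.Finite.of_finite_image (f := fun t : Creature2 => (t.mdn, t.mup, t.dis, t.val)) 
    (Set.Finite.subset (Finset.finite_toSet T) ?_) ?_
  · rintro _ ⟨t, ht, rfl⟩
    have ht' : t.mup ≤ N := ht
    have := t.hm
    have hdis : ∀ j ∈ t.dis, j < N := fun j hj => by
      have := Finset.mem_Ico.1 (t.hdis hj)
      omega
    simp only [T, Finset.coe_product, Set.mem_prod, Finset.mem_coe, Finset.mem_range,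
      Finset.mem_powerset]
    refine ⟨by omega, by omega, fun j hj => Finset.mem_range.2 (hdis j hj), fun f hf => ?_⟩
    simp only [F, Set.Finite.mem_toFinset]
    refine ⟨fun j => match h : f j with
      | none => none
      | some a => some ⟨a, t.hran f hf j a h⟩, ?_⟩
    funext j
    simp only [G]
    split_ifs with hj
    · split <;> simp_all
    · by_contra hne
      exact hj (hdis j ((t.hdom f hf j).1 (Option.isSome_iff_ne_none.2 (Ne.symm hne))))
  · intro s _ t _ h
    simp only [Prod.mk.injEq] at h
    exact ceq h.1 h.2.1 h.2.2.1 h.2.2.2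

theorem fin_restr (N : ℕ) : {b : List Creature2 | ∃ (W : R2) (j : ℕ), b = restr2 W.1 j ∧ top W.1 j ≤ N}.Finite := by
  have : Finite {t : Creature2 | t.mup ≤ N} := fin_creature N
  refine (Set.finite_range (fun p : (Σ j : Fin (N+1), Fin j.1 → {t : Creature2 | t.mup ≤ N}) =>
    List.ofFn (fun i => (p.2 i).1))).subset ?_
  rintro _ ⟨W, j, rfl, h⟩
  have hj := len_le_top W j
  exact ⟨⟨⟨j, by omega⟩, fun i => ⟨W.1 i.1, (mup_le_top W.chain i.2).trans h⟩⟩, rfl⟩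

/-! Fusion -/
section fusion
variable (P : List Creature2 → R2 → Prop)

theorem fus_single 
  (hmono : ∀ b Y Z, EBasic2 b Z ⊆ EBasic2 b Y → P b Y → P b Z)
  (hdense : ∀ b Y, (EBasic2 b Y).Nonempty → ∃ Z ∈ EBasic2 b Y, P b Z)
    (Y W : R2) (m j : ℕ) (hW : SubR W Y) (ht : top W.1 j = top Y.1 m) :
    ∃ Z ∈ EBasic2 (restr2 Y.1 m) Y, P (restr2 W.1 j) Z := by
  obtain ⟨Z', hZ', hP⟩ := hdense (restr2 W.1 j) Y ⟨W, memE'.2 ⟨hW, fun _ _ => rfl⟩⟩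
  rw [memE'] at hZ'
  have hjm := depth_ge hW ht
  have htZ : top Z'.1 j = top Y.1 m := (top_congr hZ'.2).trans ht
  let z : ℕ → Creature2 := fun i => if i < m then Y.1 i else Z'.1 i
  have zlt : ∀ i < m, z i = Y.1 i := fun i hi => by simp [z, hi]
  have zge : ∀ i, m ≤ i → z i = Z'.1 i := fun i hi => by simp [z, not_lt.2 hi]
  have hz : Chain z := by
    intro i
    rcases lt_trichotomy (i+1) m with h | h | h
    · rw [zlt i (by omega), zlt (i+1) h]; exact Y.chain i
    · rw [zlt i (by omega), zge (i+1) (by omega)]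
      subst h
      have := top_le Z'.chain hjm
      rw [htZ] at this
      exact this
    · rw [zge i (by omega), zge (i+1) (by omega)]; exact Z'.chain i
  have hzc : ∀ n, (z n).val.card = n + 1 := by
    intro n
    simp only [z]
    split_ifs
    · exact Y.card n
    · exact Z'.card n
  let Z : R2 := ⟨z, mkR hz hzc⟩
  refine ⟨Z, memE'.2 ⟨fun n => ?_, zlt⟩, hmono _ Z' Z ?_ hP⟩
  · show Blk Y.1 (z n)
    simp only [z]
    split_ifs
    · exact blk_self _ _
    · exact hZ'.1 n
  · intro V hV
    rw [memE'] at *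
    refine ⟨fun i => ?_, hV.2⟩
    by_cases hi : i < j
    · rw [hV.2 i hi, ← hZ'.2 i hi]; exact blk_self _ _
    · obtain ⟨p, l, q, h1, h2, h3, h4, h5, h6⟩ := hV.1 i
      have hp : m ≤ p := by
        apply idx_ge hz
        rw [top_congr zlt, ← ht, ← top_congr hV.2]
        exact (top_le V.chain (not_lt.1 hi)).trans h3.le
      change _ = (z p).mdn at h3
      change _ = (z q).mup at h4
      change _ = (z l).dis at h5
      change _ ⊆ (z l).val at h6
      rw [zge p hp] at h3
      rw [zge q (by omega)] at h4
      rw [zge l (by omega)] at h5 h6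
      exact ⟨p, l, q, h1, h2, h3, h4, h5, h6⟩

theorem fus_step 
  (hmono : ∀ b Y Z, EBasic2 b Z ⊆ EBasic2 b Y → P b Y → P b Z)
  (hdense : ∀ b Y, (EBasic2 b Y).Nonempty → ∃ Z ∈ EBasic2 b Y, P b Z)
    (Y : R2) (m : ℕ) :
    ∃ Z ∈ EBasic2 (restr2 Y.1 m) Y, ∀ (W : R2) (j : ℕ), SubR W Z → top W.1 j = top Z.1 m →
      P (restr2 W.1 j) Z := by
  classical
  have key : ∀ S : Finset (List Creature2), ∃ Z ∈ EBasic2 (restr2 Y.1 m) Y, ∀ (W : R2) (j : ℕ), 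
      SubR W Z → top W.1 j = top Z.1 m → restr2 W.1 j ∈ S → P (restr2 W.1 j) Z := by
    intro S
    induction S using Finset.induction_on with
    | empty => exact ⟨Y, memE'.2 ⟨SubR.rfl' Y, fun _ _ => rfl⟩, by simp⟩
    | insert b S _ ih =>
      obtain ⟨Z, hZ, h⟩ := ih
      rw [memE'] at hZ
      by_cases hb : ∃ (W : R2) (j : ℕ), SubR W Z ∧ top W.1 j = top Z.1 m ∧ restr2 W.1 j = b
      · obtain ⟨W, j, h1, h2, h3⟩ := hb
        obtain ⟨Z2, hZ2, hP⟩ := fus_single P hmono hdense Z W m j h1 h2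
        rw [memE'] at hZ2
        refine ⟨Z2, memE'.2 ⟨hZ2.1.tr hZ.1, fun i hi => (hZ2.2 i hi).trans (hZ.2 i hi)⟩, ?_⟩
        intro W' j' h1' h2' h3'
        rcases Finset.mem_insert.1 h3' with e | e
        · rw [e, ← h3]; exact hP
        · exact hmono _ Z _ (E_mono hZ2.1) 
            (h W' j' (h1'.tr hZ2.1) (h2'.trans (top_congr hZ2.2)) e)
      · refine ⟨Z, memE'.2 hZ, ?_⟩
        intro W' j' h1' h2' h3'
        rcases Finset.mem_insert.1 h3' with e | e
        · exact absurd ⟨W', j', h1', h2', e⟩ hb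
        · exact h W' j' h1' h2' e
  obtain ⟨Z, hZ, h⟩ := key (fin_restr (top Y.1 m)).toFinset
  refine ⟨Z, hZ, fun W j h1 h2 => h W j h1 h2 ?_⟩
  rw [Set.Finite.mem_toFinset]
  rw [memE'] at hZ
  exact ⟨W, j, rfl, by rw [h2, top_congr hZ.2]⟩

theorem fusion 
  (hmono : ∀ b Y Z, EBasic2 b Z ⊆ EBasic2 b Y → P b Y → P b Z)
  (hdense : ∀ b Y, (EBasic2 b Y).Nonempty → ∃ Z ∈ EBasic2 b Y, P b Z)
    (a : List Creature2) (X : R2) (hne : (EBasic2 a X).Nonempty) :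
    ∃ Y ∈ EBasic2 a X, ∀ (W : R2) (j : ℕ), SubR W Y → a.length ≤ j → P (restr2 W.1 j) Y := by
  obtain ⟨Y0, hY0⟩ := hne
  choose st hst1 hst2 using fus_step P hmono hdense
  let k := a.length
  let Ys : ℕ → R2 := fun n => Nat.rec Y0 (fun n Y => st Y (k+n)) n
  have hs : ∀ n, Ys (n+1) = st (Ys n) (k+n) := fun n => rfl
  have hle : ∀ n d, SubR (Ys (n+d)) (Ys n) ∧ ∀ i < k + n, (Ys (n+d)).1 i = (Ys n).1 i := by
    intro n d
    induction d with
    | zero => exact ⟨SubR.rfl' _, fun _ _ => rfl⟩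
    | succ d ih =>
      have := hst1 (Ys (n+d)) (k+(n+d))
      rw [← hs, memE'] at this
      exact ⟨this.1.tr ih.1, fun i hi => (this.2 i (by omega)).trans (ih.2 i hi)⟩
  let y : ℕ → Creature2 := fun i => (Ys (i+1)).1 i
  have hy : ∀ n i, i < k + n → y i = (Ys n).1 i := by
    intro n i hi
    rcases le_total n (i+1) with h | h
    · obtain ⟨d, hd⟩ := Nat.exists_eq_add_of_le h
      simp only [y]; rw [hd]; exact (hle n d).2 i hi
    · obtain ⟨d, hd⟩ := Nat.exists_eq_add_of_le h
      simp only [y]; rw [hd]; exact ((hle (i+1) d).2 i (by omega)).symm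
  have hc : Chain y := by
    intro i
    rw [hy (i+2) i (by omega), hy (i+2) (i+1) (by omega)]
    exact (Ys (i+2)).chain i
  let Y : R2 := ⟨y, mkR hc (fun n => (Ys (n+1)).card n)⟩
  have hYle : ∀ n, SubR Y (Ys n) := by
    intro n i
    show Blk _ (y i)
    rw [hy (n+(i+1)) i (by omega)]
    exact (hle n (i+1)).1 i
  rw [memE] at hY0
  refine ⟨Y, memE.2 ⟨(hYle 0).tr hY0.1, ?_⟩, ?_⟩
  · rw [← hY0.2]
    simp only [restr_len]
    rw [restr_eq]
    exact fun i hi => hy 0 i (by omega)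
  · intro W j hW hj
    obtain ⟨m, hm⟩ := depth hW j
    have hjm := depth_ge hW hm
    obtain ⟨n, hn⟩ := Nat.exists_eq_add_of_le (hj.trans hjm)
    have e := hst2 (Ys n) (k+n) W j
    rw [← hs] at e
    refine hmono _ _ _ (E_mono (hYle (n+1))) (e (hW.tr (hYle (n+1))) ?_)
    rw [hm, hn]
    exact top_congr (fun i hi => hy (n+1) i (by omega))
end fusion

/-! Pigeonhole -/
theorem pigeon (O : Set (List Creature2)) (b : List Creature2) (Y : R2)
    (hne : (EBasic2 b Y).Nonempty) : ∃ Z ∈ EBasic2 b Y,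
      (∀ V ∈ EBasic2 b Z, restr2 V.1 (b.length+1) ∈ O) ∨ 
      (∀ V ∈ EBasic2 b Z, restr2 V.1 (b.length+1) ∉ O) := by
  obtain ⟨X, hX⟩ := hne
  rw [memE] at hX
  set k := b.length with hk
  let c : ℕ → ℕ → ℕ → Finset (ℕ → Option ℕ) → Prop := fun p l q V => 
    ∃ t : Creature2, t.mdn = (X.1 p).mdn ∧ t.mup = (X.1 q).mup ∧ t.dis = (X.1 l).dis ∧ t.val = V ∧
      b ++ [t] ∈ O
  obtain ⟨p, l, q, B, d, h1, h2⟩ := comb (fun l => (X.1 l).val) X.card k (k+1) c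
  have hcr : ∀ n, ∃ t : Creature2, t.mdn = (X.1 (p n)).mdn ∧ t.mup = (X.1 (q n)).mup ∧
      t.dis = (X.1 (l n)).dis ∧ t.val = B n := by
    intro n
    obtain ⟨_, a2, a3, _, a5, a6⟩ := h1 n
    have e1 := X.chain.mdn_le a2
    have e2 := X.chain.mup_le a3
    have e3 := (X.1 (l n)).hm
    exact ⟨{ mdn := (X.1 (p n)).mdn
             mup := (X.1 (q n)).mup
             hm := by omega
             dis := (X.1 (l n)).dis
             hdisne := (X.1 (l n)).hdisne
             hdis := (X.1 (l n)).hdis.trans (Finset.Ico_subset_Ico e1 e2)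
             val := B n
             hvalne := by rw [← Finset.card_pos]; omega
             hdom := fun f hf => (X.1 (l n)).hdom f (a5 hf)
             hran := fun f hf => (X.1 (l n)).hran f (a5 hf)
             nor := _
             hnor := rfl }, rfl, rfl, rfl, rfl⟩
  choose t t1 t2 t3 t4 using hcr
  let z : ℕ → Creature2 := fun i => if i < k then X.1 i else t (i - k)
  have zlt : ∀ i < k, z i = X.1 i := fun i hi => by simp [z, hi]
  have zge : ∀ n, z (k+n) = t n := fun n => by simp [z]
  have hz : Chain z := by
    intro i
    rcases lt_trichotomy (i+1) k with h | h | h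
    · rw [zlt i (by omega), zlt (i+1) h]; exact X.chain i
    · rw [zlt i (by omega), h, show z k = t 0 from zge 0, t1]
      exact X.chain.lt (by have := (h1 0).1; omega)
    · obtain ⟨n, rfl⟩ := Nat.exists_eq_add_of_le (show k ≤ i by omega)
      rw [zge n, show z (k+n+1) = t (n+1) from zge (n+1), t1, t2]
      exact X.chain.lt (h1 n).2.2.2.1
  have hzc : ∀ n, (z n).val.card = n + 1 := by
    intro n
    by_cases h : n < k
    · rw [zlt n h]; exact X.card n
    · obtain ⟨n, rfl⟩ := Nat.exists_eq_add_of_le (not_lt.1 h)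
      rw [zge, t4]; exact (h1 n).2.2.2.2.2
  let Z : R2 := ⟨z, mkR hz hzc⟩
  have hZX : SubR Z X := by
    intro n
    show Blk _ (z n)
    by_cases h : n < k
    · rw [zlt n h]; exact blk_self _ _
    · obtain ⟨n, rfl⟩ := Nat.exists_eq_add_of_le (not_lt.1 h)
      rw [zge]
      obtain ⟨_, a2, a3, _, a5, a6⟩ := h1 n
      exact ⟨p n, l n, q n, a2, a3, t1 n, t2 n, t3 n, by rw [t4]; exact a5⟩
  have hZb : restr2 Z.1 k = b := by
    rw [← hX.2]; exact restr_eq.2 zlt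
  have main : ∀ V ∈ EBasic2 b Z, (restr2 V.1 (k+1) ∈ O ↔ d) := by
    intro V hV
    rw [memE] at hV
    have hVb : restr2 V.1 (k+1) = b ++ [V.1 k] := by
      rw [← hV.2]
      simp only [restr2, List.ofFn_succ_last, List.length_ofFn]
      simp [hk]
    obtain ⟨i, j, r, hij, hjr, e1, e2, e3, e4⟩ := hV.1 k
    have hi : k ≤ i := by
      apply idx_ge hz
      rw [show top z k = top V.1 k from ?_]
      · exact (top_le V.chain le_rfl).trans e1.le
      · apply top_congr
        rw [← restr_eq]
        exact hZb.trans hV.2.symm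
    obtain ⟨i, rfl⟩ := Nat.exists_eq_add_of_le hi
    obtain ⟨j, rfl⟩ := Nat.exists_eq_add_of_le (hi.trans hij)
    obtain ⟨r, rfl⟩ := Nat.exists_eq_add_of_le (hi.trans (hij.trans hjr))
    change _ = (z _).mdn at e1
    change _ = (z _).mup at e2
    change _ = (z _).dis at e3
    change _ ⊆ (z _).val at e4
    rw [zge, t1] at e1
    rw [zge, t2] at e2
    rw [zge, t3] at e3
    rw [zge, t4] at e4
    rw [← h2 i j r (by omega) (by omega) _ e4 (V.card k), hVb]
    constructor
    · intro h
      exact ⟨V.1 k, e1, e2, e3, rfl, h⟩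
    · rintro ⟨s, s1, s2, s3, s4, s5⟩
      rwa [← ceq (s1.trans e1.symm) (s2.trans e2.symm) (s3.trans e3.symm) s4]
  refine ⟨Z, memE.2 ⟨hZX.tr hX.1, hZb⟩, ?_⟩
  by_cases hd : d
  · left; intro V hV; exact (main V hV).2 hd
  · right; intro V hV h; exact hd ((main V hV).1 h)

/-! Topology -/
theorem E_open (a : List Creature2) (X : R2) : @IsOpen R2 ellT2 (EBasic2 a X) :=
  TopologicalSpace.isOpen_generateFrom_of_mem ⟨a, X, rfl⟩

theorem open_nhd {O : Set R2} (hO : @IsOpen R2 ellT2 O) (W : R2) (hW : W ∈ O) :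
    ∃ n, ∀ m, n ≤ m → EBasic2 (restr2 W.1 m) W ⊆ O := by
  change TopologicalSpace.GenerateOpen _ O at hO
  induction hO with
  | basic s hs =>
    obtain ⟨a, X, rfl⟩ := hs
    refine ⟨a.length, fun m hm V hV => ?_⟩
    rw [memE'] at hV
    rw [memE] at *
    exact ⟨hV.1.tr hW.1, by 
      rw [← restr_eq.2 (fun i hi => (hV.2 i (lt_of_lt_of_le hi hm)).symm)]; exact hW.2⟩
  | univ => exact ⟨0, fun _ _ _ _ => trivial⟩
  | inter s t _ _ ih1 ih2 =>
    obtain ⟨n1, h1⟩ := ih1 hW.1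
    obtain ⟨n2, h2⟩ := ih2 hW.2
    exact ⟨max n1 n2, fun m hm V hV => 
      ⟨h1 m ((le_max_left _ _).trans hm) hV, h2 m ((le_max_right _ _).trans hm) hV⟩⟩
  | sUnion S _ ih =>
    obtain ⟨s, hs, hWs⟩ := hW
    obtain ⟨n, h⟩ := ih s hs hWs
    exact ⟨n, fun m hm V hV => ⟨s, hs, h m hm hV⟩⟩

theorem self_mem {a : List Creature2} {X Y : R2} (h : Y ∈ EBasic2 a X) : Y ∈ EBasic2 a Y := by
  rw [memE] at *
  exact ⟨SubR.rfl' _, h.2⟩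

theorem open_ramsey {O : Set R2} (hO : @IsOpen R2 ellT2 O) : Ramsey2 O := by
  intro a X hne
  obtain ⟨Y, hY, hdec⟩ := fusion 
    (fun b Y => EBasic2 b Y ⊆ O ∨ ∀ Z ∈ EBasic2 b Y, ¬ EBasic2 b Z ⊆ O)
    (fun b Y Z h hP => hP.imp (fun h' => h.trans h') (fun h' V hV => h' V (h hV)))
    (by
      intro b Y hne
      by_cases h : ∃ Z ∈ EBasic2 b Y, EBasic2 b Z ⊆ O
      · obtain ⟨Z, hZ, h⟩ := h
        exact ⟨Z, hZ, Or.inl h⟩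
      · push Not at h
        obtain ⟨Z, hZ⟩ := hne
        exact ⟨Z, hZ, Or.inr fun V hV => h V (E_mono (memE.1 hZ).1 hV)⟩)
    a X hne
  by_cases hYO : EBasic2 a Y ⊆ O
  · exact ⟨Y, hY, Or.inl hYO⟩
  obtain ⟨Z, hZ, hhom⟩ := fusion 
    (fun b Z => (∀ V ∈ EBasic2 b Z, restr2 V.1 (b.length+1) ∈ {b | EBasic2 b Y ⊆ O}) ∨
      (∀ V ∈ EBasic2 b Z, restr2 V.1 (b.length+1) ∉ {b | EBasic2 b Y ⊆ O}))
    (fun b Y Z h hP => hP.imp (fun h' V hV => h' V (h hV)) (fun h' V hV => h' V (h hV)))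
    (pigeon _) a Y ⟨Y, self_mem hY⟩
  have hZY := (memE.1 hZ).1
  have rej : ∀ W ∈ EBasic2 a Z, ∀ n, ¬ EBasic2 (restr2 W.1 (a.length + n)) Y ⊆ O := by
    intro W hW n
    have hWZ := (memE.1 hW).1
    induction n with
    | zero => simpa [(memE.1 hW).2] using hYO
    | succ n ih =>
      intro hc
      have hW' : ∀ X, SubR W X → W ∈ EBasic2 (restr2 W.1 (a.length + n)) X := fun X h =>
        memE'.2 ⟨h, fun _ _ => rfl⟩
      have hh := hhom W (a.length + n) hWZ (by omega)
      simp only [restr_len, Set.mem_ofPred_eq] at hh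
      have hh' := hh.resolve_right (fun h => h W (hW' Z hWZ) hc)
      have hsub : EBasic2 (restr2 W.1 (a.length + n)) W ⊆ O := by
        intro V hV
        have hV' := E_mono hWZ hV
        exact hh' V hV' (memE'.2 ⟨(memE.1 hV').1.tr hZY, fun _ _ => rfl⟩)
      rcases hdec W (a.length + n) (hWZ.tr hZY) (by omega) with h | h
      · exact ih h
      · exact h W (hW' Y (hWZ.tr hZY)) hsub
  refine ⟨Z, E_mono (memE.1 hY).1 hZ, Or.inr ?_⟩
  rw [Set.eq_empty_iff_forall_notMem]
  rintro W ⟨hW, hWO⟩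
  have hWZ := (memE.1 hW).1
  obtain ⟨n, hn⟩ := open_nhd hO W hWO
  rcases hdec W (a.length + n) (hWZ.tr hZY) (by omega) with h | h
  · exact rej W hW n h
  · exact h W (memE'.2 ⟨hWZ.tr hZY, fun _ _ => rfl⟩) (hn _ (by omega))

theorem nd_null {N : Set R2} (hN : @IsNowhereDense R2 ellT2 N) : RamseyNull2 N := by
  let _ := ellT2
  intro a X hne
  obtain ⟨Y, hY, h⟩ := open_ramsey (O := (closure N)ᶜ) isClosed_closure.isOpen_compl a X hne
  refine ⟨Y, hY, ?_⟩
  rcases h with h | h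
  · rw [Set.eq_empty_iff_forall_notMem]
    rintro W ⟨hW, hWN⟩
    exact h hW (subset_closure hWN)
  · exfalso
    have h1 : EBasic2 a Y ⊆ closure N := by
      intro W hW
      by_contra hc
      exact (Set.eq_empty_iff_forall_notMem.1 h W) ⟨hW, hc⟩
    have h2 := interior_maximal h1 (E_open a Y) (self_mem hY)
    have h3 : interior (closure N) = ∅ := hN
    rw [h3] at h2
    exact h2

theorem meagre_null {M : Set R2} (hM : @IsMeagre R2 ellT2 M) : RamseyNull2 M := by
  let _ := ellT2
  obtain ⟨S, hS, hSc, hMS⟩ := isMeagre_iff_countable_union_isNowhereDense.1 hM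
  have hSc' : (insert ∅ S).Countable := hSc.insert _
  obtain ⟨f, hf⟩ := hSc'.exists_eq_range (by simp)
  have hnd : ∀ n, RamseyNull2 (f n) := by
    intro n
    have : f n ∈ insert ∅ S := hf ▸ Set.mem_range_self n
    rcases this with h | h
    · rw [h]; exact nd_null (by simp [IsNowhereDense])
    · exact nd_null (hS _ h)
  intro a X hne
  obtain ⟨Y, hY, h⟩ := fusion
    (fun b Y => ∀ i < b.length, EBasic2 b Y ∩ f i = ∅)
    (fun b Y Z h hP i hi => Set.subset_eq_empty (Set.inter_subset_inter_left _ h) (hP i hi))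
    (by
      intro b Y hne
      have : ∀ n, ∃ Z ∈ EBasic2 b Y, ∀ i < n, EBasic2 b Z ∩ f i = ∅ := by
        intro n
        induction n with
        | zero => obtain ⟨Z, hZ⟩ := hne; exact ⟨Z, hZ, by simp⟩
        | succ n ih =>
          obtain ⟨Z, hZ, h⟩ := ih
          obtain ⟨V, hV, h'⟩ := hnd n b Z ⟨Z, self_mem hZ⟩
          refine ⟨V, E_mono (memE.1 hZ).1 hV, fun i hi => ?_⟩
          rcases Nat.lt_succ_iff_lt_or_eq.1 hi with e | e
          · exact Set.subset_eq_empty (Set.inter_subset_inter_left _ (E_mono (memE.1 hV).1)) (h i e)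
          · subst e; exact h'
      exact this _) a X hne
  refine ⟨Y, hY, ?_⟩
  rw [Set.eq_empty_iff_forall_notMem]
  rintro W ⟨hW, hWM⟩
  obtain ⟨s, hs, hWs⟩ := hMS hWM
  have : s ∈ Set.range f := hf ▸ Set.mem_insert_of_mem _ hs
  obtain ⟨n, rfl⟩ := this
  have e := h W (a.length + n + 1) (memE.1 hW).1 (by omega) n (by rw [restr_len]; omega)
  exact (Set.eq_empty_iff_forall_notMem.1 e W) ⟨memE'.2 ⟨(memE.1 hW).1, fun _ _ => rfl⟩, hWs⟩

theorem baire_ramsey {M : Set R2} (hM : BaireProp2 M) : Ramsey2 M := by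
  obtain ⟨O, hO, hm⟩ := hM
  intro a X hne
  obtain ⟨Y, hY, h⟩ := meagre_null hm a X hne
  obtain ⟨Z, hZ, h'⟩ := open_ramsey hO a Y ⟨Y, self_mem hY⟩
  refine ⟨Z, E_mono (memE.1 hY).1 hZ, ?_⟩
  have key : ∀ W ∈ EBasic2 a Z, (W ∈ M ↔ W ∈ O) := by
    intro W hW
    have := Set.eq_empty_iff_forall_notMem.1 h W
    have hWY := E_mono (memE.1 hZ).1 hW
    simp only [Set.mem_inter_iff, Set.mem_symmDiff] at this
    tauto
  rcases h' with h' | h'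
  · exact Or.inl fun W hW => (key W hW).2 (h' hW)
  · right
    rw [Set.eq_empty_iff_forall_notMem] at *
    rintro W ⟨hW, hWM⟩
    exact h' W ⟨hW, (key W hW).1 hWM⟩

theorem dense_R (t : ℕ → Creature2) (ht : PC2 t) : ∃ s, R2cond s ∧ le2 s t := by
  have hc : Chain t := ht.1
  have hbig : ∀ N n : ℕ, ∃ m, N < m ∧ n + 1 ≤ (t m).val.card := by
    intro N n
    obtain ⟨m, h1, h2⟩ := ((eventually_gt_atTop N).and 
      (ht.2.eventually (eventually_ge_atTop (Real.logb 2 ((n:ℝ) + 1))))).exists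
    refine ⟨m, h1, ?_⟩
    rw [(t m).hnor] at h2
    have hp : (0:ℝ) < (t m).val.card := by
      exact_mod_cast Finset.card_pos.2 (t m).hvalne
    have := (Real.logb_le_logb (by norm_num) (by positivity) hp).1 h2
    exact_mod_cast this
  choose g hg1 hg2 using hbig
  let m : ℕ → ℕ := fun n => Nat.rec (g 0 0) (fun n x => g x (n+1)) n
  have hm1 : ∀ n, m n < m (n+1) := fun n => hg1 _ _
  have hm2 : ∀ n, n + 1 ≤ (t (m n)).val.card := by
    intro n
    cases n with
    | zero => exact hg2 _ _
    | succ n => exact hg2 _ _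
  have hs : ∀ n, ∃ s : Creature2, s.mdn = (t (m n)).mdn ∧ s.mup = (t (m n)).mup ∧
      s.dis = (t (m n)).dis ∧ s.val ⊆ (t (m n)).val ∧ s.val.card = n + 1 := by
    intro n
    obtain ⟨B, hB, hBc⟩ := Finset.exists_subset_card_eq (hm2 n)
    exact ⟨{ t (m n) with 
             val := B
             hvalne := by rw [← Finset.card_pos]; omega
             hdom := fun f hf => (t (m n)).hdom f (hB hf)
             hran := fun f hf => (t (m n)).hran f (hB hf)
             nor := _
             hnor := rfl }, rfl, rfl, rfl, hB, hBc⟩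
  choose s s1 s2 s3 s4 s5 using hs
  have hsc : Chain s := by
    intro n
    rw [s1, s2]
    exact hc.lt (hm1 n)
  exact ⟨s, mkR hsc s5, (le2_iff hc hsc).2 fun n =>
    ⟨m n, m n, m n, le_rfl, le_rfl, s1 n, s2 n, s3 n, s4 n⟩⟩

theorem nonempty_R : Nonempty R2 := by
  classical
  let F : ℕ → ℕ → ℕ → Option ℕ := fun n i j =>
    if j ∈ Finset.Ico (n^2) (n^2+n+1) then some (if j = n^2 + i then 1 else 0) else none
  have hinj : ∀ n, Set.InjOn (F n) (Finset.range (n+1)) := by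
    intro n i hi i' hi' h
    have hi := Finset.mem_range.1 hi
    have := congrFun h (n^2+i)
    simp only [F, Finset.mem_Ico] at this
    rw [if_pos (by omega)] at this
    by_contra hne
    simp [hne] at this
  let t : ℕ → Creature2 := fun n =>
    { mdn := n^2
      mup := n^2 + n + 1
      hm := by omega
      dis := Finset.Ico (n^2) (n^2+n+1)
      hdisne := by simp
      hdis := fun _ h => h
      val := (Finset.range (n+1)).image (F n)
      hvalne := by simp
      hdom := by
        intro f hf j
        obtain ⟨i, _, rfl⟩ := Finset.mem_image.1 hf
        simp only [F]
        split_ifs with h <;> simp [h]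
      hran := by
        intro f hf j a
        obtain ⟨i, _, rfl⟩ := Finset.mem_image.1 hf
        simp only [F]
        split_ifs <;> simp <;> omega
      nor := _
      hnor := rfl }
  refine ⟨⟨t, mkR (fun n => ?_) (fun n => ?_)⟩⟩
  · show n^2 + n + 1 ≤ (n+1)^2
    nlinarith
  · show ((Finset.range (n+1)).image (F n)).card = n + 1
    rw [Finset.card_image_of_injOn (hinj n), Finset.card_range]

/- STATEMENT 13 (Theorem `ex.1.11RamseySpace`):
(R(K_2, Σ_2), ≤, r) is a topological Ramsey space (every subset with the property of
Baire in the Ellentuck topology is Ramsey, and every Ellentuck-meager subset is Ramsey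
null), and R(K_2, Σ_2) is dense in the partial ordering PC_∞(K_2, Σ_2) of all pure
candidates. -/
theorem stmt13 :
    Nonempty R2 ∧
    (∀ 𝓧 : Set R2, BaireProp2 𝓧 → Ramsey2 𝓧) ∧
    (∀ 𝓧 : Set R2, @IsMeagre R2 ellT2 𝓧 → RamseyNull2 𝓧) ∧
    (∀ t : ℕ → Creature2, PC2 t → ∃ s : ℕ → Creature2, R2cond s ∧ le2 s t) := by
  exact ⟨nonempty_R, fun _ h => baire_ramsey h, fun _ h => meagre_null h, dense_R⟩
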